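/- arXiv:2103.06962 — 2 statements merged into one kernel-verified Lean document; each statement's English description precedes it below -/
import Mathlib

section
/- Let X ∈ ℝ^{n×m} with k ≤ min(n,m). If all consecutive r-minors of X are positive for 1 ≤ r ≤ k−1, and all consecutive k-minors of X are nonnegative, then X is k-positive (all minors of order up to k, consecutive or not, are nonnegative). -/
open Matrix BigOperators

/-- The `r`-th multiplicative compound matrix. -/
def compound {R : Type*} [CommRing R] {n m : ℕ} (X : Matrix (Fin n) (Fin m) R) (r : ℕ) :
    Matrix {s : Finset (Fin n) // s.card = r} {s : Finset (Fin m) // s.card = r} R :=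
  fun I J => (X.submatrix (I.1.orderEmbOfFin I.2) (J.1.orderEmbOfFin J.2)).det

/-- The alternating sum of maximal minors against a column vanishes. -/
lemma fk_alt_sum {N : ℕ} (M : Fin (N + 1) → Fin N → ℝ) (j : Fin N) :
    ∑ i : Fin (N + 1), (-1 : ℝ) ^ (i : ℕ) * M i j *
      (Matrix.of fun a => M (i.succAbove a)).det = 0 := by
  have h : (Matrix.of fun i => (Fin.cons (M i j) (M i) : Fin (N + 1) → ℝ)).det = 0 := by
    apply Matrix.det_zero_of_column_eq (i := 0) (j := j.succ) (Fin.succ_ne_zero j).symm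
    intro k
    simp
  rw [Matrix.det_succ_column_zero] at h
  rw [← h]
  apply Finset.sum_congr rfl
  intro i _
  simp only [Matrix.of_apply, Fin.cons_zero]
  congr 2

/-- Three-term Plücker relation for maximal minors. -/
lemma fk_plucker {r : ℕ} (M : Fin (r + 3) → Fin (r + 2) → ℝ) (q : Fin (r + 1)) :
    (Matrix.of fun i => M (q.castSucc.succ.succAbove i)).det *
      (Matrix.of fun (i : Fin (r + 1)) (j : Fin (r + 1)) => M i.castSucc.succ j.castSucc).det =
    (Matrix.of fun (i : Fin (r + 2)) => M i.castSucc).det *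
      (Matrix.of fun (i : Fin (r + 1)) (j : Fin (r + 1)) =>
        M (q.castSucc.succAbove i).succ j.castSucc).det +
    (Matrix.of fun (i : Fin (r + 2)) => M i.succ).det *
      (Matrix.of fun (i : Fin (r + 1)) (j : Fin (r + 1)) =>
        M (q.succ.succAbove i).castSucc j.castSucc).det := by
  let M' : Fin (r + 3) → Fin (r + 1) → ℝ := fun i j => M i j.castSucc
  let w : Fin r → Fin (r + 1) → ℝ := fun i => M' (q.succAbove i).castSucc.succ
  let D : (Fin (r + 1) → ℝ) [⋀^Fin (r + 1)]→ₗ[ℝ] ℝ := Matrix.detRowAlternating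
  let L : (Fin (r + 1) → ℝ) →ₗ[ℝ] ℝ :=
    { toFun := fun v => D (Matrix.vecCons v w)
      map_add' := fun x y => D.map_vecCons_add w x y
      map_smul' := fun c x => D.map_vecCons_smul w c x }
  let c : Fin (r + 3) → ℝ := fun i =>
    (-1 : ℝ) ^ (i : ℕ) * (Matrix.of fun a => M (i.succAbove a)).det
  have hsum : ∑ i, c i • M' i = 0 := by
    funext j
    have := fk_alt_sum M j.castSucc
    simp only [Finset.sum_apply, Pi.smul_apply, smul_eq_mul, Pi.zero_apply]
    rw [← this]
    apply Finset.sum_congr rfl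
    intro i _
    simp only [c, M']
    ring
  have hL : ∑ i, c i * L (M' i) = 0 := by
    have := congrArg L hsum
    simpa using this
  have hw : ∀ i, L (w i) = 0 := by
    intro i
    refine D.map_eq_zero_of_eq _ (i := 0) (j := i.succ) ?_ (Fin.succ_ne_zero i).symm
    simp
  rw [Fin.sum_univ_succ, Fin.sum_univ_castSucc, Fin.sum_univ_succAbove _ q] at hL
  have hz : ∑ i : Fin r, c (q.succAbove i).castSucc.succ * L (M' (q.succAbove i).castSucc.succ)
      = 0 := by
    apply Finset.sum_eq_zero
    intro i _
    rw [hw i, mul_zero]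
  rw [hz] at hL
  have h0 : L (M' 0) = (Matrix.of fun (i : Fin (r + 1)) (j : Fin (r + 1)) =>
        M (q.succ.succAbove i).castSucc j.castSucc).det := by
    change Matrix.det _ = _
    congr 1
    funext i
    refine Fin.cases ?_ (fun i => ?_) i
    · funext j; simp [M']
    · funext j; simp [M', w]
  have hq : L (M' q.castSucc.succ) = (-1) ^ (q : ℕ) *
      (Matrix.of fun (i : Fin (r + 1)) (j : Fin (r + 1)) => M i.castSucc.succ j.castSucc).det := by
    have := D.neg_one_pow_smul_map_insertNth q (M' q.castSucc.succ) w
    change D _ = _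
    rw [← this]
    have e : (q.insertNth (M' q.castSucc.succ) w : Fin (r + 1) → Fin (r + 1) → ℝ) =
        fun i => M' i.castSucc.succ := by
      rw [Fin.insertNth_eq_iff]
      exact ⟨rfl, rfl⟩
    rw [e]
    simp [D, M', Matrix.det]
    rfl
  have hl : L (M' (Fin.last (r + 1)).succ) = (-1) ^ r *
      (Matrix.of fun (i : Fin (r + 1)) (j : Fin (r + 1)) =>
        M (q.castSucc.succAbove i).succ j.castSucc).det := by
    have := D.neg_one_pow_smul_map_insertNth (Fin.last r) (M' (Fin.last (r + 1)).succ) w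
    change D _ = _
    rw [← this]
    have e : ((Fin.last r).insertNth (M' (Fin.last (r + 1)).succ) w :
        Fin (r + 1) → Fin (r + 1) → ℝ) = fun i => M' (q.castSucc.succAbove i).succ := by
      rw [Fin.insertNth_eq_iff]
      constructor
      · congr 1
        simp
      · funext i
        simp [w, Fin.removeNth]
    rw [e]
    simp [D, M', Matrix.det]
    rfl
  rw [h0, hq, hl] at hL
  have c0 : c 0 = (Matrix.of fun (i : Fin (r + 2)) => M i.succ).det := by
    simp [c]
  have cl : c (Fin.last (r + 1)).succ =
      (-1) ^ r * (Matrix.of fun (i : Fin (r + 2)) => M i.castSucc).det := by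
    simp [c, pow_succ]
  have cq : c q.castSucc.succ = -((-1) ^ (q : ℕ) *
      (Matrix.of fun i => M (q.castSucc.succ.succAbove i)).det) := by
    simp [c, pow_succ]
  rw [c0, cl, cq] at hL
  have s1 : ((-1 : ℝ) ^ (q : ℕ)) * (-1) ^ (q : ℕ) = 1 := by
    rw [← mul_pow]; simp
  have s2 : ((-1 : ℝ) ^ r) * (-1) ^ r = 1 := by
    rw [← mul_pow]; simp
  generalize (Matrix.of fun i => M (q.castSucc.succ.succAbove i)).det = x1 at *
  generalize (Matrix.of fun (i : Fin (r + 1)) (j : Fin (r + 1)) =>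
    M i.castSucc.succ j.castSucc).det = x2 at *
  generalize (Matrix.of fun (i : Fin (r + 2)) => M i.castSucc).det = x3 at *
  generalize (Matrix.of fun (i : Fin (r + 2)) => M i.succ).det = x4 at *
  generalize (Matrix.of fun (i : Fin (r + 1)) (j : Fin (r + 1)) =>
        M (q.castSucc.succAbove i).succ j.castSucc).det = x5 at *
  generalize (Matrix.of fun (i : Fin (r + 1)) (j : Fin (r + 1)) =>
        M (q.succ.succAbove i).castSucc j.castSucc).det = x6 at *
  linear_combination -hL - (x1 * x2) * s1 + x3 * x5 * s2

/-- A row-wise Fekete lemma, for a sign predicate `P` (positive or nonnegative). -/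
lemma fk_rows (P : ℝ → Prop)
    (hP : ∀ x y z a b c : ℝ, P x → P y → 0 < a → 0 < b → 0 < c →
      z * c = x * a + y * b → P z)
    (N s : ℕ) (A : ℕ → Fin (s + 1) → ℝ)
    (h1 : ∀ f : Fin s → ℕ, StrictMono f → (∀ i, f i < N) →
      0 < (Matrix.of fun (i j : Fin s) => A (f i) j.castSucc).det)
    (h2 : ∀ a, a + (s + 1) ≤ N → P (Matrix.of fun (i : Fin (s + 1)) => A (a + i)).det) :
    ∀ d, ∀ f : Fin (s + 1) → ℕ, StrictMono f → (∀ i, f i < N) → f (Fin.last s) - f 0 ≤ d →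
      P (Matrix.of fun i => A (f i)).det := by
  intro d
  induction d using Nat.strong_induction_on with
  | _ d ih =>
  intro f hf hN hd
  by_cases hgap : ∃ q : Fin s, f q.castSucc + 1 < f q.succ
  · obtain ⟨q, hq⟩ := hgap
    obtain ⟨r, rfl⟩ : ∃ r, s = r + 1 := ⟨s - 1, by have := q.2; omega⟩
    let g : Fin (r + 3) → ℕ := Fin.insertNth q.castSucc.succ (f q.castSucc + 1) f
    have hg : StrictMono g :=
      Fin.strictMono_insertNth hf q _ (Nat.lt_succ_self _) hq
    have hgf : ∀ i, g (q.castSucc.succ.succAbove i) = f i := fun i => by simp [g]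
    have hgN : ∀ i, g i < N := by
      intro i
      refine Fin.succAboveCases q.castSucc.succ ?_ (fun i => ?_) i
      · have := hN q.succ
        simp only [g, Fin.insertNth_apply_same]
        omega
      · rw [hgf]; exact hN i
    have hg0 : g 0 = f 0 := by
      rw [← hgf 0]; congr 1
    have hgl : g (Fin.last _) = f (Fin.last _) := by
      rw [← hgf (Fin.last _)]; congr 1
      rw [Fin.succAbove_of_le_castSucc]
      · simp
      · rw [Fin.le_def]
        simp only [Fin.val_succ, Fin.val_castSucc, Fin.val_last]
        have := q.2
        omega
    have key := fk_plucker (fun i => A (g i)) q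
    simp only [hgf] at key
    have hpos : f 0 < f (Fin.last (r + 1)) := hf (Fin.last_pos)
    refine hP _ _ _ _ _ _ ?_ ?_ ?_ ?_ ?_ key
    · refine ih (d - 1) (by omega) (fun i => g i.castSucc) (hg.comp Fin.strictMono_castSucc)
        (fun i => hgN _) ?_
      have : g (Fin.last (r + 1)).castSucc < g (Fin.last _) := hg (Fin.castSucc_lt_last _)
      simp only [Fin.castSucc_zero]
      omega
    · refine ih (d - 1) (by omega) (fun i => g i.succ) (hg.comp Fin.strictMono_succ)
        (fun i => hgN _) ?_
      have : g 0 < g (Fin.succ 0) := hg (Fin.succ_pos _)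
      change g (Fin.last (r + 2)) - g (Fin.succ 0) ≤ d - 1
      omega
    · exact h1 (fun i => g (q.castSucc.succAbove i).succ)
        (hg.comp (Fin.strictMono_succ.comp (Fin.strictMono_succAbove _))) (fun i => hgN _)
    · exact h1 (fun i => g (q.succ.succAbove i).castSucc)
        (hg.comp (Fin.strictMono_castSucc.comp (Fin.strictMono_succAbove _))) (fun i => hgN _)
    · exact h1 (fun i => g i.castSucc.succ)
        (hg.comp (Fin.strictMono_succ.comp Fin.strictMono_castSucc)) (fun i => hgN _)
  · push Not at hgap
    have hfe : ∀ i, f i = f 0 + (i : ℕ) := by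
      intro i
      induction i using Fin.induction with
      | zero => simp
      | succ i ihi =>
        have a := hgap i
        have b := hf (Fin.castSucc_lt_succ (i := i))
        simp only [Fin.val_castSucc, Fin.val_succ] at *
        omega
    have h := h2 (f 0) (by
      have a := hN (Fin.last s)
      rw [hfe] at a
      simp only [Fin.val_last] at a
      omega)
    have e : (fun i => A (f i)) = fun i : Fin (s + 1) => A (f 0 + i) := by
      funext i; rw [hfe]
    rw [e]
    exact h

/-- Both rows and columns: passing from order `s` to order `s + 1`. -/
lemma fk_step (P : ℝ → Prop)
    (hP : ∀ x y z a b c : ℝ, P x → P y → 0 < a → 0 < b → 0 < c →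
      z * c = x * a + y * b → P z)
    (n m s : ℕ) (Y : ℕ → ℕ → ℝ)
    (h1 : ∀ f g : Fin s → ℕ, StrictMono f → StrictMono g → (∀ i, f i < n) → (∀ i, g i < m) →
      0 < (Matrix.of fun (i j : Fin s) => Y (f i) (g j)).det)
    (h2 : ∀ a b, a + (s + 1) ≤ n → b + (s + 1) ≤ m →
      P (Matrix.of fun (i j : Fin (s + 1)) => Y (a + i) (b + j)).det) :
    ∀ f g : Fin (s + 1) → ℕ, StrictMono f → StrictMono g → (∀ i, f i < n) → (∀ i, g i < m) →
      P (Matrix.of fun (i j : Fin (s + 1)) => Y (f i) (g j)).det := by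
  intro f g hf hg hfn hgm
  have hA : ∀ b, b + (s + 1) ≤ m →
      P (Matrix.of fun (i j : Fin (s + 1)) => Y (f i) (b + j)).det := by
    intro b hb
    refine fk_rows P hP n s (fun a j => Y a (b + j)) ?_ (fun a ha => h2 a b ha hb) _ f hf hfn le_rfl
    intro f' hf' hn'
    exact h1 f' (fun j => b + j) hf' (fun i j h => by simpa using h) hn'
      (fun i => by have := i.2; omega)
  rw [← Matrix.det_transpose]
  refine fk_rows P hP m s (fun c j => Y (f j) c) ?_ ?_ _ g hg hgm le_rfl
  · intro g' hg' hm'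
    rw [← Matrix.det_transpose]
    exact h1 (fun i => f i.castSucc) g' (hf.comp Fin.strictMono_castSucc) hg' (fun i => hfn _) hm'
  · intro b hb
    rw [← Matrix.det_transpose]
    exact hA b hb

/-- Fekete-type criterion: if all consecutive `r`-minors of `X` are positive for
`1 ≤ r ≤ k−1` and all consecutive `k`-minors are nonnegative, then `X` is `k`-positive,
i.e. all minors of order up to `k` are nonnegative. -/
theorem kPositive_of_consecutive_minors {n m : ℕ} (k : ℕ) (hk : k ≤ min n m)
    (X : Matrix (Fin n) (Fin m) ℝ)
    (hcons : ∀ r, 1 ≤ r → r ≤ k - 1 → ∀ a b, ∀ (ha : a + r ≤ n) (hb : b + r ≤ m),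
      0 < (X.submatrix (fun t : Fin r => (⟨a + t.1, by omega⟩ : Fin n))
        (fun t : Fin r => (⟨b + t.1, by omega⟩ : Fin m))).det)
    (hconsk : ∀ a b, ∀ (ha : a + k ≤ n) (hb : b + k ≤ m),
      0 ≤ (X.submatrix (fun t : Fin k => (⟨a + t.1, by omega⟩ : Fin n))
        (fun t : Fin k => (⟨b + t.1, by omega⟩ : Fin m))).det) :
    ∀ j, 1 ≤ j → j ≤ k → ∀ I J, 0 ≤ compound X j I J := by
  classical
  let Y : ℕ → ℕ → ℝ := fun a b => if h : a < n ∧ b < m then X ⟨a, h.1⟩ ⟨b, h.2⟩ else 0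
  have hYX : ∀ (s a b : ℕ) (ha : a + s ≤ n) (hb : b + s ≤ m),
      (Matrix.of fun (i j : Fin s) => Y (a + i) (b + j)) =
      X.submatrix (fun t : Fin s => (⟨a + t.1, by omega⟩ : Fin n))
        (fun t : Fin s => (⟨b + t.1, by omega⟩ : Fin m)) := by
    intro s a b ha hb
    ext i j
    have hc : a + (i : ℕ) < n ∧ b + (j : ℕ) < m := ⟨by omega, by omega⟩
    simp [Y, hc]
  have hpos : ∀ s, s < k → ∀ f g : Fin s → ℕ, StrictMono f → StrictMono g →
      (∀ i, f i < n) → (∀ i, g i < m) →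
      0 < (Matrix.of fun (i j : Fin s) => Y (f i) (g j)).det := by
    intro s
    induction s with
    | zero => intro _ f g _ _ _ _; simp
    | succ s ih =>
      intro hs
      refine fk_step (fun x => 0 < x) ?_ n m s Y (ih (by omega)) ?_
      · intro x y z a b c hx hy ha hb hc h
        have : 0 < z * c := by rw [h]; positivity
        exact pos_of_mul_pos_left this hc.le
      · intro a b ha hb
        rw [hYX (s + 1) a b ha hb]
        exact hcons (s + 1) (by omega) (by omega) a b ha hb
  have hnn : ∀ s, s ≤ k → ∀ f g : Fin s → ℕ, StrictMono f → StrictMono g →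
      (∀ i, f i < n) → (∀ i, g i < m) →
      0 ≤ (Matrix.of fun (i j : Fin s) => Y (f i) (g j)).det := by
    intro s hs f g hf hg hfn hgm
    rcases Nat.lt_or_ge s k with h | h
    · exact (hpos s h f g hf hg hfn hgm).le
    obtain rfl : s = k := by omega
    cases s with
    | zero => simp
    | succ s =>
      refine fk_step (fun x => 0 ≤ x) ?_ n m s Y (hpos s (by omega)) ?_ f g hf hg hfn hgm
      · intro x y z a b c hx hy ha hb hc h
        have : 0 ≤ z * c := by rw [h]; positivity
        exact nonneg_of_mul_nonneg_left this hc
      · intro a b ha hb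
        rw [hYX (s + 1) a b ha hb]
        exact hconsk a b ha hb
  intro j _ hjk I J
  have h := hnn j hjk (fun i => (I.1.orderEmbOfFin I.2 i : ℕ)) (fun i => (J.1.orderEmbOfFin J.2 i : ℕ))
    (fun a b hab => (I.1.orderEmbOfFin I.2).strictMono hab)
    (fun a b hab => (J.1.orderEmbOfFin J.2).strictMono hab)
    (fun i => Fin.is_lt _) (fun i => Fin.is_lt _)
  have e : (Matrix.of fun (i l : Fin j) =>
      Y (I.1.orderEmbOfFin I.2 i : ℕ) (J.1.orderEmbOfFin J.2 l : ℕ)) =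
      X.submatrix (I.1.orderEmbOfFin I.2) (J.1.orderEmbOfFin J.2) := by
    ext i l
    simp [Y]
  rw [e] at h
  exact h
end

section
/- (Main theorem, controllability part) Let A ∈ ℝ^{K×K} be k-positive, and suppose (C_j(A,b))_[j] ≥ 0 for 1 ≤ j ≤ k and rank(A^{K−j} C_j(A,b)) = j for 1 ≤ j ≤ k−1. Then the truncated controllability matrix C_t(A,b) = [b, Ab, …, A^{t−1}b] is k-positive for every t ≥ k. -/
open Matrix BigOperators

/-- The truncated controllability matrix `C_j(A,b) = [b, Ab, …, A^{j−1} b]`. -/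
def ctrb {K : ℕ} (A : Matrix (Fin K) (Fin K) ℝ) (b : Fin K → ℝ) (j : ℕ) :
    Matrix (Fin K) (Fin j) ℝ :=
  fun i q => (A ^ (q : ℕ)).mulVec b i

/-- Cauchy–Binet in symmetrised form. -/
theorem cb_sum {n K : ℕ} (M : Matrix (Fin n) (Fin K) ℝ) (N : Matrix (Fin K) (Fin n) ℝ) :
    ∑ f : Fin n → Fin K, (M.submatrix id f).det * (N.submatrix f id).det
      = (Nat.factorial n : ℝ) * (M * N).det := by
  have h1 : ∀ P : Matrix (Fin n) (Fin K) ℝ, (P * N).det =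
      ∑ f : Fin n → Fin K, (∏ i, P i (f i)) * (N.submatrix f id).det := by
    intro P
    have : (P * N) = Matrix.of (fun i => ∑ k, P i k • N k) := by
      ext i j
      simp [Matrix.mul_apply, Finset.sum_apply]
    rw [this]
    change Matrix.detRowAlternating (fun i => ∑ k, P i k • N k) = _
    rw [← AlternatingMap.coe_multilinearMap, MultilinearMap.map_sum]
    refine Finset.sum_congr rfl fun f _ => ?_
    rw [MultilinearMap.map_smul_univ]
    rfl
  have h2 : ∀ σ : Equiv.Perm (Fin n),
      ∑ f : Fin n → Fin K, ((Equiv.Perm.sign σ : ℤ) : ℝ) * (∏ i, M (σ i) (f i)) *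
        (N.submatrix f id).det = (M * N).det := by
    intro σ
    have h3 := h1 (M.submatrix σ id)
    have h4 : (M.submatrix σ id * N) = (M * N).submatrix σ id := by
      ext i j; simp [Matrix.mul_apply]
    rw [h4, Matrix.det_permute] at h3
    simp_rw [mul_assoc]
    rw [← Finset.mul_sum]
    simp only [Matrix.submatrix_apply, id] at h3
    rw [← h3, ← mul_assoc]
    rcases Int.units_eq_one_or (Equiv.Perm.sign σ) with h | h <;> simp [h]
  simp_rw [Matrix.det_apply' (M.submatrix id _), Finset.sum_mul]
  rw [Finset.sum_comm]
  simp only [Matrix.submatrix_apply, id]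
  rw [Finset.sum_congr rfl (fun σ _ => h2 σ)]
  simp [Fintype.card_perm]

theorem sorted_perm {n K : ℕ} (f : Fin n → Fin K) (hf : Function.Injective f) :
    ∃ (g : Fin n → Fin K) (σ : Equiv.Perm (Fin n)), StrictMono g ∧ f = g ∘ σ := by
  refine ⟨f ∘ Tuple.sort f, (Tuple.sort f).symm, ?_, ?_⟩
  · exact (Tuple.monotone_sort f).strictMono_of_injective (hf.comp (Equiv.injective _))
  · funext i; simp

theorem cb_term {n K : ℕ} (M : Matrix (Fin n) (Fin K) ℝ) (N : Matrix (Fin K) (Fin n) ℝ)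
    (f : Fin n → Fin K) :
    (M.submatrix id f).det * (N.submatrix f id).det = 0 ∨
    ∃ g : Fin n → Fin K, StrictMono g ∧ (M.submatrix id f).det * (N.submatrix f id).det =
      (M.submatrix id g).det * (N.submatrix g id).det := by
  by_cases hf : Function.Injective f
  · right
    obtain ⟨g, σ, hg, rfl⟩ := sorted_perm f hf
    refine ⟨g, hg, ?_⟩
    have h1 : M.submatrix id (g ∘ σ) = (M.submatrix id g).submatrix id σ := rfl
    have h2 : N.submatrix (g ∘ σ) id = (N.submatrix g id).submatrix σ id := rfl
    rw [h1, h2, Matrix.det_permute, Matrix.det_permute']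
    rcases Int.units_eq_one_or (Equiv.Perm.sign σ) with h | h <;> simp [h]
  · left
    simp only [Function.Injective, not_forall] at hf
    obtain ⟨a, b, hab, hne⟩ := hf
    rw [Matrix.det_zero_of_row_eq (M := N.submatrix f id) hne, mul_zero]
    funext j; simp [hab]

theorem cb_nonneg {n K : ℕ} (M : Matrix (Fin n) (Fin K) ℝ) (N : Matrix (Fin K) (Fin n) ℝ)
    (hM : ∀ g : Fin n → Fin K, StrictMono g → 0 ≤ (M.submatrix id g).det)
    (hN : ∀ g : Fin n → Fin K, StrictMono g → 0 ≤ (N.submatrix g id).det) :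
    0 ≤ (M * N).det := by
  have h := cb_sum M N
  have hpos : (0 : ℝ) < Nat.factorial n := by exact_mod_cast Nat.factorial_pos n
  refine (mul_nonneg_iff_of_pos_left hpos).1 ?_
  rw [← h]
  refine Finset.sum_nonneg fun f _ => ?_
  rcases cb_term M N f with h0 | ⟨g, hg, h0⟩
  · rw [h0]
  · rw [h0]; exact mul_nonneg (hM g hg) (hN g hg)

theorem cb_pos {n K : ℕ} (M : Matrix (Fin n) (Fin K) ℝ) (N : Matrix (Fin K) (Fin n) ℝ)
    (hM : ∀ g : Fin n → Fin K, StrictMono g → 0 < (M.submatrix id g).det)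
    (hN : ∀ g : Fin n → Fin K, StrictMono g → 0 ≤ (N.submatrix g id).det)
    (hex : ∃ g : Fin n → Fin K, StrictMono g ∧ (N.submatrix g id).det ≠ 0) :
    0 < (M * N).det := by
  have h := cb_sum M N
  have hpos : (0 : ℝ) < Nat.factorial n := by exact_mod_cast Nat.factorial_pos n
  refine pos_of_mul_pos_right (a := (Nat.factorial n : ℝ)) ?_ hpos.le
  rw [← h]
  refine Finset.sum_pos' (fun f _ => ?_) ?_
  · rcases cb_term M N f with h0 | ⟨g, hg, h0⟩
    · rw [h0]
    · rw [h0]; exact mul_nonneg (hM g hg).le (hN g hg)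
  · obtain ⟨g, hg, h0⟩ := hex
    exact ⟨g, Finset.mem_univ _, mul_pos (hM g hg) (lt_of_le_of_ne (hN g hg) h0.symm)⟩

theorem cb_exists {n K : ℕ} (M : Matrix (Fin n) (Fin K) ℝ) (N : Matrix (Fin K) (Fin n) ℝ)
    (h : (M * N).det ≠ 0) : ∃ g : Fin n → Fin K, StrictMono g ∧ (N.submatrix g id).det ≠ 0 := by
  by_contra! hcon
  have hs := cb_sum M N
  rw [Finset.sum_eq_zero] at hs
  · have hpos : (Nat.factorial n : ℝ) ≠ 0 := by exact_mod_cast Nat.factorial_ne_zero n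
    rcases mul_eq_zero.1 hs.symm with h' | h'
    · exact hpos h'
    · exact h h'
  · intro f _
    rcases cb_term M N f with h0 | ⟨g, hg, h0⟩
    · exact h0
    · rw [h0, hcon g hg, mul_zero]

/-- Linearly independent families have a nonvanishing maximal minor. -/
theorem exists_minor_ne {n K : ℕ} (w : Fin n → Fin K → ℝ) (hw : LinearIndependent ℝ w) :
    ∃ g : Fin n → Fin K, StrictMono g ∧ (Matrix.of fun a b => w a (g b)).det ≠ 0 := by
  have hr : (Matrix.of w).rank = n := by
    have := LinearIndependent.rank_matrix (M := Matrix.of w) hw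
    simpa using this
  have h2 : ((Matrix.of w) * (Matrix.of w)ᵀ).rank = n := by
    rw [Matrix.rank_self_mul_transpose, hr]
  have h3 : ((Matrix.of w) * (Matrix.of w)ᵀ).det ≠ 0 := by
    intro h0
    obtain ⟨x, hx, hx0⟩ := Matrix.exists_mulVec_eq_zero_iff.2 h0
    have hli : LinearIndependent ℝ ((Matrix.of w) * (Matrix.of w)ᵀ).col := by
      rw [linearIndependent_iff_card_eq_finrank_span, Set.finrank, ← Matrix.rank_eq_finrank_span_cols, h2]
      simp
    exact hx (Matrix.mulVec_injective_iff.2 hli (by rw [hx0, Matrix.mulVec_zero]))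
  obtain ⟨g, hg, h⟩ := cb_exists _ _ h3
  refine ⟨g, hg, ?_⟩
  rw [← Matrix.det_transpose] at h
  exact h

open Polynomial in
theorem signVar_lt (m : ℕ) : ∀ P : Polynomial ℝ, P ≠ 0 → P.support.card ≤ m →
    P.signVariations + 1 ≤ m := by
  induction m with
  | zero =>
    intro P hP h
    exact absurd (by simpa using h) hP
  | succ m ih =>
    intro P hP h
    by_cases h0 : P.eraseLead = 0
    · have h1 : P = monomial P.natDegree P.leadingCoeff := by
        have := P.eraseLead_add_monomial_natDegree_leadingCoeff
        rw [h0, zero_add] at this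
        exact this.symm
      rw [h1, signVariations_monomial]; omega
    · have h1 := Polynomial.eraseLead_support_card_lt hP
      have h2 := ih _ h0 (by omega)
      have h3 := signVariations_le_eraseLead_succ (P := P)
      omega

open Polynomial in
theorem genVandermonde_pos (n : ℕ) : ∀ (x : Fin n → ℝ) (a : Fin n → ℕ), (∀ i, 0 < x i) →
    StrictMono x → StrictMono a → 0 < (Matrix.of fun i j => x i ^ a j).det := by
  induction n with
  | zero => intros; simp
  | succ n ih =>
    intro x a hx0 hx ha
    let c : Fin (n+1) → ℝ := fun j => (-1) ^ (n + (j : ℕ)) *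
      (Matrix.of fun (i : Fin n) (l : Fin n) => x i.castSucc ^ a (j.succAbove l)).det
    let P : ℝ[X] := ∑ j, C (c j) * X ^ (a j)
    have heval : ∀ y : ℝ, P.eval y =
        (Matrix.of fun i j => (Fin.snoc (fun i : Fin n => x i.castSucc) y : Fin (n+1) → ℝ) i ^ a j).det := by
      intro y
      rw [Matrix.det_succ_row _ (Fin.last n)]
      simp only [P, eval_finsetSum, c]
      refine Finset.sum_congr rfl fun j _ => ?_
      simp only [eval_mul, eval_C, eval_pow, eval_X, Matrix.of_apply, Fin.snoc_last, Fin.val_last]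
      rw [mul_right_comm]
      congr 2
      ext i l
      simp [Matrix.submatrix_apply]
    have hcl : 0 < c (Fin.last n) := by
      have := ih (fun i => x i.castSucc) (fun l => a l.castSucc) (fun i => hx0 _)
        (fun i j h => hx (by simpa using h)) (fun i j h => ha (by simpa using h))
      simp only [c, Fin.val_last, Fin.succAbove_last]
      rw [Even.neg_one_pow ⟨n, rfl⟩, one_mul]
      exact this
    have hcoeff : ∀ m, P.coeff m = ∑ j, if m = a j then c j else 0 := by
      intro m
      simp [P, coeff_C_mul, coeff_X_pow]
    have hlc : P.coeff (a (Fin.last n)) = c (Fin.last n) := by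
      rw [hcoeff, Finset.sum_eq_single (Fin.last n)]
      · simp
      · intro j _ hj
        rw [if_neg]
        intro h; exact hj (ha.injective h).symm
      · simp
    have hP : P ≠ 0 := by
      intro h; rw [h] at hlc; simp at hlc; linarith
    have hdeg : P.natDegree = a (Fin.last n) := by
      apply le_antisymm
      · refine natDegree_sum_le_of_forall_le _ _ fun j _ => ?_
        exact (natDegree_C_mul_X_pow_le _ _).trans (ha.monotone (Fin.le_last j))
      · exact le_natDegree_of_ne_zero (by rw [hlc]; exact hcl.ne')
    have hsupp : P.support.card ≤ n + 1 := by
      have : P.support ⊆ Finset.univ.image a := by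
        intro m hm
        by_contra hcon
        rw [mem_support_iff, hcoeff] at hm
        apply hm
        refine Finset.sum_eq_zero fun j _ => ?_
        rw [if_neg]
        rintro rfl
        exact hcon (Finset.mem_image_of_mem _ (Finset.mem_univ _))
      exact (Finset.card_le_card this).trans (Finset.card_image_le.trans (by simp))
    have hsv := signVar_lt _ P hP hsupp
    have hD := roots_countP_pos_le_signVariations P
    have hroot : ∀ i : Fin n, P.eval (x i.castSucc) = 0 := by
      intro i
      rw [heval]
      refine Matrix.det_zero_of_row_eq (i := i.castSucc) (j := Fin.last n) (Fin.castSucc_lt_last i).ne ?_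
      funext j; simp
    have hlast : P.eval (x (Fin.last n)) = (Matrix.of fun i j => x i ^ a j).det := by
      rw [heval]
      congr 3
      funext i
      rw [show (Fin.snoc (fun i : Fin n => x i.castSucc) (x (Fin.last n)) : Fin (n+1) → ℝ) = x from
        Fin.snoc_init_self x]
    rw [← hlast]
    by_contra! hneg
    -- a root above `x last`
    obtain ⟨z, hz, hz0⟩ : ∃ z, x (Fin.last n) ≤ z ∧ P.eval z = 0 := by
      rcases Nat.eq_zero_or_pos P.natDegree with hd | hd
      · exfalso
        rw [eq_C_of_natDegree_eq_zero hd] at hneg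
        rw [hdeg] at hd
        rw [hd] at hlc
        simp [hlc] at hneg
        linarith
      · have htend : Filter.Tendsto (fun y => P.eval y) Filter.atTop Filter.atTop := by
          apply Polynomial.tendsto_atTop_of_leadingCoeff_nonneg
          · exact natDegree_pos_iff_degree_pos.1 hd
          · rw [leadingCoeff, hdeg, hlc]; exact hcl.le
        obtain ⟨y, hy, hy1⟩ := ((htend.eventually_ge_atTop 0).and
          (Filter.eventually_ge_atTop (x (Fin.last n)))).exists
        obtain ⟨z, hz, hz0⟩ := intermediate_value_Icc hy1 (P.continuous.continuousOn) ⟨hneg, hy⟩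
        exact ⟨z, hz.1, hz0⟩
    let r : Fin (n+1) → ℝ := Fin.snoc (fun i : Fin n => x i.castSucc) z
    have hr_inj : Function.Injective r := by
      refine StrictMono.injective (α := Fin (n+1)) ?_
      intro i j hij
      induction j using Fin.lastCases with
      | last =>
        induction i using Fin.lastCases with
        | last => exact absurd hij (lt_irrefl _)
        | cast i => simp only [r, Fin.snoc_castSucc, Fin.snoc_last]; exact (hx hij).trans_le hz
      | cast j =>
        induction i using Fin.lastCases with
        | last => exact absurd hij (not_lt.2 (Fin.le_last _))
        | cast i => simp only [r, Fin.snoc_castSucc]; exact hx hij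
    have hr : ∀ i, 0 < r i ∧ P.eval (r i) = 0 := by
      intro i
      induction i using Fin.lastCases with
      | last => simp only [r, Fin.snoc_last]; exact ⟨(hx0 _).trans_le hz, hz0⟩
      | cast i => simp only [r, Fin.snoc_castSucc]; exact ⟨hx0 _, hroot i⟩
    have hcard : n + 1 ≤ P.roots.countP (0 < ·) := by
      rw [Multiset.countP_eq_card_filter]
      have h1 : Finset.univ.image r ⊆ (P.roots.filter (0 < ·)).toFinset := by
        intro y hy
        obtain ⟨i, _, rfl⟩ := Finset.mem_image.1 hy
        rw [Multiset.mem_toFinset, Multiset.mem_filter, mem_roots hP]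
        exact ⟨(hr i).2, (hr i).1⟩
      have h2 := Finset.card_le_card h1
      rw [Finset.card_image_of_injective _ hr_inj] at h2
      simp only [Finset.card_univ, Fintype.card_fin] at h2
      exact h2.trans (Multiset.toFinset_card_le _)
    omega

/-- The Gaussian matrix in the variable `q = exp (-σ)`. -/
noncomputable def gaussM (K : ℕ) (q : ℝ) : Matrix (Fin K) (Fin K) ℝ :=
  Matrix.of fun i j => q ^ (((i : ℤ) - (j : ℤ)).natAbs ^ 2)

theorem gaussM_zero (K : ℕ) : gaussM K 0 = 1 := by
  ext i j
  by_cases h : i = j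
  · subst h; simp [gaussM]
  · simp only [gaussM, Matrix.of_apply, Matrix.one_apply_ne h]
    apply zero_pow
    have : (i : ℕ) ≠ j := fun h' => h (Fin.ext h')
    have : ((i : ℤ) - (j : ℤ)).natAbs ≠ 0 := by omega
    positivity

theorem gaussM_pos {K n : ℕ} (q : ℝ) (hq0 : 0 < q) (hq1 : q < 1) (f g : Fin n → Fin K)
    (hf : StrictMono f) (hg : StrictMono g) : 0 < ((gaussM K q).submatrix f g).det := by
  have hexp : ∀ i j : Fin K, gaussM K q i j =
      q ^ ((i : ℕ)^2) * (q ^ ((j : ℕ)^2) * ((q⁻¹ ^ (2 * (i : ℕ))) ^ (j : ℕ))) := by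
    intro i j
    simp only [gaussM, Matrix.of_apply]
    have hq : q ≠ 0 := hq0.ne'
    rw [← pow_mul, ← mul_assoc, ← pow_add, inv_pow, eq_mul_inv_iff_mul_eq₀ (pow_ne_zero _ hq),
      ← pow_add]
    congr 1
    zify
    rw [sq_abs]
    ring
  have : (gaussM K q).submatrix f g = Matrix.of fun i j => q ^ ((f i : ℕ)^2) *
      ((Matrix.of fun i j => q ^ ((g j : ℕ)^2) *
        ((Matrix.of fun (i j : Fin n) => (q⁻¹ ^ (2 * (f i : ℕ))) ^ (g j : ℕ)) i j)) i j) := by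
    ext i j
    simp only [Matrix.submatrix_apply, hexp, Matrix.of_apply]
  rw [this]
  have e1 := Matrix.det_mul_column (fun i => q ^ ((f i : ℕ)^2)) (Matrix.of fun i j => q ^ ((g j : ℕ)^2) *
        ((Matrix.of fun (i j : Fin n) => (q⁻¹ ^ (2 * (f i : ℕ))) ^ (g j : ℕ)) i j))
  have e2 := Matrix.det_mul_row (fun j => q ^ ((g j : ℕ)^2)) (Matrix.of fun (i j : Fin n) => (q⁻¹ ^ (2 * (f i : ℕ))) ^ (g j : ℕ))
  rw [e1, e2]
  refine mul_pos (Finset.prod_pos fun i _ => by positivity)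
    (mul_pos (Finset.prod_pos fun i _ => by positivity) ?_)
  refine genVandermonde_pos n (fun i => q⁻¹ ^ (2 * (f i : ℕ))) (fun j => (g j : ℕ))
    (fun i => by positivity) ?_ (fun i j h => hg h)
  intro i j h
  apply pow_lt_pow_right₀ ((one_lt_inv₀ hq0).2 hq1)
  have := hf h
  rw [Fin.lt_def] at this
  omega

/-- Three-term Plücker relation. -/
theorem pluecker {n : ℕ} (T : Fin n → Fin (n+2) → ℝ) (e x p q : Fin (n+2) → ℝ) :
    (Matrix.of (Fin.cons e (Fin.cons x T) : Fin (n+2) → Fin (n+2) → ℝ)).det *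
      (Matrix.of (Fin.cons p (Fin.cons q T) : Fin (n+2) → Fin (n+2) → ℝ)).det =
    (Matrix.of (Fin.cons e (Fin.cons p T) : Fin (n+2) → Fin (n+2) → ℝ)).det *
      (Matrix.of (Fin.cons x (Fin.cons q T) : Fin (n+2) → Fin (n+2) → ℝ)).det +
    (Matrix.of (Fin.cons e (Fin.cons q T) : Fin (n+2) → Fin (n+2) → ℝ)).det *
      (Matrix.of (Fin.cons p (Fin.cons x T) : Fin (n+2) → Fin (n+2) → ℝ)).det := by
  set B : Matrix (Fin (n+2)) (Fin (n+2)) ℝ := Matrix.of (Fin.cons p (Fin.cons q T)) with hB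
  -- the linear functional `y ↦ det (e, y, T)`
  let φ : (Fin (n+2) → ℝ) →ₗ[ℝ] ℝ :=
    { toFun := fun y => (Matrix.of (Fin.cons e (Fin.cons y T) : Fin (n+2) → Fin (n+2) → ℝ)).det
      map_add' := by
        intro y z
        have := Matrix.det_updateRow_add (Matrix.of (Fin.cons e (Fin.cons y T) : Fin (n+2) → Fin (n+2) → ℝ)) 1 y z
        convert this using 2
        · ext i j
          refine Fin.cases ?_ (fun i => ?_) i
          · simp [Matrix.updateRow_apply]
          · refine Fin.cases ?_ (fun i => ?_) i
            · simp [Matrix.updateRow_apply]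
            · simp [Matrix.updateRow_apply, Fin.ext_iff]
        · congr 1
          ext i j
          refine Fin.cases ?_ (fun i => ?_) i
          · simp [Matrix.updateRow_apply]
          · refine Fin.cases ?_ (fun i => ?_) i
            · simp [Matrix.updateRow_apply]
            · simp [Matrix.updateRow_apply, Fin.ext_iff]
        · congr 1
          ext i j
          refine Fin.cases ?_ (fun i => ?_) i
          · simp [Matrix.updateRow_apply]
          · refine Fin.cases ?_ (fun i => ?_) i
            · simp [Matrix.updateRow_apply]
            · simp [Matrix.updateRow_apply, Fin.ext_iff]
      map_smul' := by
        intro c z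
        have := Matrix.det_updateRow_smul (Matrix.of (Fin.cons e (Fin.cons z T) : Fin (n+2) → Fin (n+2) → ℝ)) 1 c z
        simp only [RingHom.id_apply, smul_eq_mul]
        convert this using 2
        · ext i j
          refine Fin.cases ?_ (fun i => ?_) i
          · simp [Matrix.updateRow_apply]
          · refine Fin.cases ?_ (fun i => ?_) i
            · simp [Matrix.updateRow_apply]
            · simp [Matrix.updateRow_apply, Fin.ext_iff]
        · congr 1
          ext i j
          refine Fin.cases ?_ (fun i => ?_) i
          · simp [Matrix.updateRow_apply]
          · refine Fin.cases ?_ (fun i => ?_) i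
            · simp [Matrix.updateRow_apply]
            · simp [Matrix.updateRow_apply, Fin.ext_iff] }
  have hφ : ∀ y, φ y = (Matrix.of (Fin.cons e (Fin.cons y T) : Fin (n+2) → Fin (n+2) → ℝ)).det :=
    fun _ => rfl
  have hT : ∀ i, φ (T i) = 0 := by
    intro i
    rw [hφ]
    refine Matrix.det_zero_of_row_eq (i := 1) (j := i.succ.succ) (by simp [Fin.ext_iff]) ?_
    funext j
    rw [← Fin.succ_zero_eq_one]
    simp
  have hc := Matrix.mulVec_cramer Bᵀ x
  rw [Matrix.det_transpose] at hc
  have hc2 : B.det • x = ∑ i, (B.updateRow i x).det • B i := by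
    rw [← hc]
    ext j
    simp only [Matrix.mulVec, dotProduct, Matrix.transpose_apply, Finset.sum_apply, Pi.smul_apply,
      smul_eq_mul, Matrix.cramer_transpose_apply]
    exact Finset.sum_congr rfl fun i _ => mul_comm _ _
  have h := congrArg φ hc2
  rw [map_smul, map_sum, Fin.sum_univ_succ, Fin.sum_univ_succ] at h
  simp only [map_smul, smul_eq_mul] at h
  have hB0 : B 0 = p := rfl
  have hB1 : B (Fin.succ 0) = q := rfl
  have hB2 : ∀ i : Fin n, B i.succ.succ = T i := fun i => rfl
  simp only [hB0, hB1, hB2, hT, mul_zero, Finset.sum_const_zero, add_zero] at h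
  have hu0 : B.updateRow 0 x = Matrix.of (Fin.cons x (Fin.cons q T)) := by
    ext i j
    refine Fin.cases ?_ (fun i => ?_) i
    · simp [Matrix.updateRow_apply]
    · simp [Matrix.updateRow_apply, hB]
  have hu1 : B.updateRow (Fin.succ 0) x = Matrix.of (Fin.cons p (Fin.cons x T)) := by
    ext i j
    refine Fin.cases ?_ (fun i => ?_) i
    · simp [Matrix.updateRow_apply, hB]
    · refine Fin.cases ?_ (fun i => ?_) i
      · simp [Matrix.updateRow_apply]
      · simp [Matrix.updateRow_apply, Fin.ext_iff, hB]
  rw [hu0, hu1] at h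
  simp only [hφ] at h
  linarith [h]

/-- Minors of a sequence of vectors. -/
noncomputable def sminor {K n : ℕ} (v : ℕ → Fin K → ℝ) (I : Fin n → Fin K) (c : Fin n → ℕ) : ℝ :=
  (Matrix.of fun a b => v (c a) (I b)).det

theorem det_insertNth {n : ℕ} (m : Fin (n+1)) (y : Fin (n+1) → ℝ) (S : Fin n → Fin (n+1) → ℝ) :
    (Matrix.of (Fin.insertNth m y S : Fin (n+1) → Fin (n+1) → ℝ)).det =
      (-1) ^ (m : ℕ) * (Matrix.of (Fin.cons y S : Fin (n+1) → Fin (n+1) → ℝ)).det := by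
  have := (Matrix.detRowAlternating (R := ℝ) (n := Fin (n+1))).map_insertNth m y S
  rw [zsmul_eq_mul'] at this
  rw [mul_comm]
  simpa using! this

theorem det_cons_insertNth {n : ℕ} (m : Fin (n+1)) (a y : Fin (n+2) → ℝ) (S : Fin n → Fin (n+2) → ℝ) :
    (Matrix.of (Fin.cons a (Fin.insertNth m y S : Fin (n+1) → Fin (n+2) → ℝ) : Fin (n+2) → Fin (n+2) → ℝ)).det =
      (-1) ^ (m : ℕ) * (Matrix.of (Fin.cons a (Fin.cons y S) : Fin (n+2) → Fin (n+2) → ℝ)).det := by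
  have h1 : (Fin.cons a (Fin.insertNth m y S : Fin (n+1) → Fin (n+2) → ℝ) : Fin (n+2) → Fin (n+2) → ℝ)
      = Fin.insertNth m.succ y (Fin.cons a S : Fin (n+1) → Fin (n+2) → ℝ) := by
    rw [Fin.eq_insertNth_iff]
    refine ⟨by simp, ?_⟩
    funext i
    refine Fin.cases ?_ (fun i => ?_) i
    · simp [Fin.removeNth]
    · simp [Fin.removeNth]
  have h2 : (Fin.cons a (Fin.cons y S : Fin (n+1) → Fin (n+2) → ℝ) : Fin (n+2) → Fin (n+2) → ℝ)
      = Fin.insertNth (Fin.succ 0) y (Fin.cons a S : Fin (n+1) → Fin (n+2) → ℝ) := by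
    rw [Fin.eq_insertNth_iff]
    refine ⟨by simp, ?_⟩
    funext i
    refine Fin.cases ?_ (fun i => ?_) i
    · simp [Fin.removeNth]
    · simp [Fin.removeNth]
  rw [h1, h2, det_insertNth, det_insertNth]
  simp only [Fin.val_succ, Fin.val_zero]
  ring

theorem det_cons_swap {n : ℕ} (a y : Fin (n+2) → ℝ) (S : Fin n → Fin (n+2) → ℝ) :
    (Matrix.of (Fin.cons a (Fin.cons y S) : Fin (n+2) → Fin (n+2) → ℝ)).det =
      - (Matrix.of (Fin.cons y (Fin.cons a S) : Fin (n+2) → Fin (n+2) → ℝ)).det := by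
  have h2 : (Fin.cons a (Fin.cons y S : Fin (n+1) → Fin (n+2) → ℝ) : Fin (n+2) → Fin (n+2) → ℝ)
      = Fin.insertNth (Fin.succ 0) y (Fin.cons a S : Fin (n+1) → Fin (n+2) → ℝ) := by
    rw [Fin.eq_insertNth_iff]
    refine ⟨by simp, ?_⟩
    funext i
    refine Fin.cases ?_ (fun i => ?_) i
    · simp [Fin.removeNth]
    · simp [Fin.removeNth]
  rw [h2, det_insertNth]
  simp

theorem det_cons_single {n : ℕ} (S : Fin n → Fin (n+1) → ℝ) :
    (Matrix.of (Fin.cons (Pi.single 0 1) S : Fin (n+1) → Fin (n+1) → ℝ)).det =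
      (Matrix.of fun a b => S a (Fin.succ b)).det := by
  rw [Matrix.det_succ_row_zero, Fin.sum_univ_succ]
  simp
  rfl

theorem sminor_insert {K n : ℕ} (v : ℕ → Fin K → ℝ) (I : Fin (n+1) → Fin K) (m : Fin (n+1)) (x : ℕ)
    (T : Fin n → ℕ) : sminor v I (Fin.insertNth m x T : Fin (n+1) → ℕ) =
      (Matrix.of (Fin.insertNth m (fun b => v x (I b)) (fun a b => v (T a) (I b)) :
        Fin (n+1) → Fin (n+1) → ℝ)).det := by
  unfold sminor
  congr 2
  rw [Fin.eq_insertNth_iff]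
  refine ⟨by simp, ?_⟩
  funext i
  simp [Fin.removeNth]

theorem sminor_cons {K n : ℕ} (v : ℕ → Fin K → ℝ) (I : Fin (n+1) → Fin K) (x : ℕ)
    (T : Fin n → ℕ) : sminor v I (Fin.cons x T : Fin (n+1) → ℕ) =
      (Matrix.of (Fin.cons (fun b => v x (I b)) (fun a b => v (T a) (I b)) :
        Fin (n+1) → Fin (n+1) → ℝ)).det := by
  unfold sminor
  congr 2
  funext i
  refine Fin.cases ?_ (fun i => ?_) i <;> simp

theorem sminor_succ {K n : ℕ} (v : ℕ → Fin K → ℝ) (I : Fin (n+1) → Fin K) (c : Fin n → ℕ) :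
    sminor v (fun b => I b.succ) c = (Matrix.of (Fin.cons (Pi.single 0 1)
      (fun a b => v (c a) (I b)) : Fin (n+1) → Fin (n+1) → ℝ)).det := by
  rw [det_cons_single]; rfl

theorem fun_insert {K n r : ℕ} (v : ℕ → Fin K → ℝ) (I : Fin r → Fin K) (m : Fin (n+1)) (x : ℕ)
    (T : Fin n → ℕ) : (fun (a : Fin (n+1)) b => v ((Fin.insertNth m x T : Fin (n+1) → ℕ) a) (I b)) =
      (Fin.insertNth m (fun b => v x (I b)) (fun a b => v (T a) (I b)) : Fin (n+1) → Fin r → ℝ) := by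
  rw [Fin.eq_insertNth_iff]
  refine ⟨by simp, ?_⟩
  funext i
  simp [Fin.removeNth]

theorem sminor_identity {K n : ℕ} (v : ℕ → Fin K → ℝ) (I : Fin (n+2) → Fin K) (m : Fin (n+1))
    (T : Fin n → ℕ) (p x q : ℕ) :
    sminor v (fun b => I b.succ) (Fin.insertNth m x T : Fin (n+1) → ℕ) *
      sminor v I (Fin.cons p (Fin.insertNth (Fin.last n) q T : Fin (n+1) → ℕ) : Fin (n+2) → ℕ) =
    sminor v (fun b => I b.succ) (Fin.insertNth 0 p T : Fin (n+1) → ℕ) *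
      sminor v I (Fin.insertNth (Fin.last (n+1)) q (Fin.insertNth m x T : Fin (n+1) → ℕ) : Fin (n+2) → ℕ) +
    sminor v (fun b => I b.succ) (Fin.insertNth (Fin.last n) q T : Fin (n+1) → ℕ) *
      sminor v I (Fin.cons p (Fin.insertNth m x T : Fin (n+1) → ℕ) : Fin (n+2) → ℕ) := by
  have h := pluecker (fun a b => v (T a) (I b)) (Pi.single 0 1) (fun b => v x (I b))
    (fun b => v p (I b)) (fun b => v q (I b))
  rw [sminor_succ, sminor_succ, sminor_succ, sminor_insert, sminor_cons, sminor_cons]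
  simp only [fun_insert]
  rw [det_insertNth (Fin.last (n+1))]
  simp only [det_cons_insertNth]
  rw [det_cons_swap (fun b => v q (I b)) (fun b => v x (I b))]
  simp only [Fin.val_last, Fin.val_zero, pow_zero, one_mul, pow_succ]
  linear_combination ((-1 : ℝ)^(m : ℕ) * (-1)^n) * h

/-- One step of the Fekete-type argument. -/
theorem fekete_step {K n : ℕ} (v : ℕ → Fin K → ℝ) (T : Fin n → ℕ) (p x q : ℕ) (m : Fin (n+1))
    (h1 : ∀ I : Fin (n+1) → Fin K, StrictMono I →
      0 ≤ sminor v I (Fin.insertNth m x T : Fin (n+1) → ℕ))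
    (h3 : ∀ I : Fin (n+1) → Fin K, StrictMono I →
      0 ≤ sminor v I (Fin.insertNth 0 p T : Fin (n+1) → ℕ))
    (h4 : ∀ I : Fin (n+2) → Fin K, StrictMono I → 0 ≤ sminor v I
      (Fin.insertNth (Fin.last (n+1)) q (Fin.insertNth m x T : Fin (n+1) → ℕ) : Fin (n+2) → ℕ))
    (h5 : ∀ I : Fin (n+1) → Fin K, StrictMono I →
      0 ≤ sminor v I (Fin.insertNth (Fin.last n) q T : Fin (n+1) → ℕ))
    (h6 : ∀ I : Fin (n+2) → Fin K, StrictMono I → 0 ≤ sminor v I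
      (Fin.cons p (Fin.insertNth m x T : Fin (n+1) → ℕ) : Fin (n+2) → ℕ))
    (hli : LinearIndependent ℝ (fun a => v ((Fin.insertNth m x T : Fin (n+1) → ℕ) a)))
    (I : Fin (n+2) → Fin K) (hI : StrictMono I) :
    0 ≤ sminor v I
      (Fin.cons p (Fin.insertNth (Fin.last n) q T : Fin (n+1) → ℕ) : Fin (n+2) → ℕ) := by
  let w : ℝ → ℕ → Fin K → ℝ := fun t s => gaussM K t *ᵥ v s
  have hw : ∀ (r : ℕ) (J : Fin r → Fin K) (c : Fin r → ℕ) (t : ℝ), sminor (w t) J c =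
      ((gaussM K t).submatrix J id * (Matrix.of fun a b => v (c b) a)).det := by
    intro r J c t
    rw [sminor, ← Matrix.det_transpose]
    congr 1
  have hN : ∀ (r : ℕ) (g : Fin r → Fin K) (c : Fin r → ℕ),
      ((Matrix.of fun a b => v (c b) a).submatrix g id).det = sminor v g c := by
    intro r g c
    rw [sminor, ← Matrix.det_transpose]
    rfl
  have hnn : ∀ (r : ℕ) (c : Fin r → ℕ) (t : ℝ), 0 < t → t < 1 →
      (∀ J : Fin r → Fin K, StrictMono J → 0 ≤ sminor v J c) →
      (∀ J : Fin r → Fin K, StrictMono J → 0 ≤ sminor (w t) J c) := by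
    intro r c t ht0 ht1 h J hJ
    rw [hw]
    refine cb_nonneg _ _ (fun g hg => ?_) (fun g hg => ?_)
    · exact (gaussM_pos t ht0 ht1 J g hJ hg).le
    · rw [hN]; exact h g hg
  have hpos : ∀ t : ℝ, 0 < t → t < 1 → 0 ≤ sminor (w t) I
      (Fin.cons p (Fin.insertNth (Fin.last n) q T : Fin (n+1) → ℕ) : Fin (n+2) → ℕ) := by
    intro t ht0 ht1
    have hIs : StrictMono (fun b : Fin (n+1) => I b.succ) :=
      fun a b h => hI (Fin.succ_lt_succ_iff.2 h)
    have hid := sminor_identity (w t) I m T p x q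
    have hp : 0 < sminor (w t) (fun b : Fin (n+1) => I b.succ)
        (Fin.insertNth m x T : Fin (n+1) → ℕ) := by
      rw [hw]
      refine cb_pos _ _ (fun g hg => ?_) (fun g hg => ?_) ?_
      · exact gaussM_pos t ht0 ht1 _ g hIs hg
      · rw [hN]; exact h1 g hg
      · obtain ⟨g, hg, hne⟩ := exists_minor_ne _ hli
        refine ⟨g, hg, ?_⟩
        rw [hN]; exact hne
    refine (mul_nonneg_iff_of_pos_left hp).1 ?_
    rw [hid]
    exact add_nonneg (mul_nonneg (hnn _ _ t ht0 ht1 h3 _ hIs) (hnn _ _ t ht0 ht1 h4 _ hI))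
      (mul_nonneg (hnn _ _ t ht0 ht1 h5 _ hIs) (hnn _ _ t ht0 ht1 h6 _ hI))
  have hcont : Continuous fun t : ℝ => sminor (w t) I
      (Fin.cons p (Fin.insertNth (Fin.last n) q T : Fin (n+1) → ℕ) : Fin (n+2) → ℕ) := by
    unfold sminor
    refine Continuous.matrix_det ?_
    refine continuous_pi fun a => continuous_pi fun b => ?_
    simp only [Matrix.of_apply, w, Matrix.mulVec, dotProduct, gaussM]
    fun_prop
  have hw0 : w 0 = v := by
    funext s
    simp [w, gaussM_zero]
  have hlim : Filter.Tendsto (fun t : ℝ => sminor (w t) I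
      (Fin.cons p (Fin.insertNth (Fin.last n) q T : Fin (n+1) → ℕ) : Fin (n+2) → ℕ))
      (nhdsWithin 0 (Set.Ioi 0)) (nhds (sminor v I
      (Fin.cons p (Fin.insertNth (Fin.last n) q T : Fin (n+1) → ℕ) : Fin (n+2) → ℕ))) := by
    have := hcont.tendsto 0
    rw [hw0] at this
    exact this.mono_left nhdsWithin_le_nhds
  refine ge_of_tendsto hlim ?_
  filter_upwards [Ioo_mem_nhdsGT (show (0:ℝ) < 1 by norm_num)] with t ht
  exact hpos t ht.1 ht.2

theorem exists_insert_pos {n : ℕ} (T : Fin n → ℕ) (hT : StrictMono T) (x : ℕ)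
    (hx : ∀ i, T i ≠ x) : ∃ m : Fin (n+1), StrictMono (Fin.insertNth m x T : Fin (n+1) → ℕ) := by
  have hle : (Finset.univ.filter fun i => T i < x).card ≤ n :=
    (Finset.card_le_univ _).trans (by simp)
  refine ⟨⟨(Finset.univ.filter fun i => T i < x).card, by omega⟩, ?_⟩
  rw [Fin.strictMono_insertNth_iff]
  have key := fun j : Fin n =>
    Tuple.lt_card_lt_iff_apply_lt_of_monotone (j := j) (a := x) (f := T) hT.monotone
  refine ⟨hT, fun i hi => ?_, fun i hi => ?_⟩
  · exact (key i).1 hi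
  · have h1 : ¬ T i < x := fun h => by
      have h2 := (key i).2 h
      rw [Fin.le_def] at hi
      simp only [Fin.val_castSucc] at hi
      omega
    exact lt_of_le_of_ne (not_lt.1 h1) (hx i).symm

/-- If the vectors strictly between `p` and `q` of a Krylov sequence lie in a subspace of too small
dimension then so does the `q`-th one. -/
theorem krylov_mem {K n : ℕ} (A : Matrix (Fin K) (Fin K) ℝ) (v : ℕ → Fin K → ℝ)
    (hv : ∀ s r, v (s + r) = (A ^ r) *ᵥ v s) (W : Submodule ℝ (Fin K → ℝ))
    (hW : Module.finrank ℝ W ≤ n) (p q : ℕ) (hpq : p + n + 2 ≤ q)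
    (hmem : ∀ x, p < x → x < q → v x ∈ W) : v q ∈ W := by
  have hdep : ¬ LinearIndependent ℝ (fun i : Fin (n+1) => v (p + 1 + i)) := by
    intro hli
    let u : Fin (n+1) → W := fun i => ⟨v (p+1+i), hmem _ (by omega) (by omega)⟩
    have hu : LinearIndependent ℝ u := by
      apply LinearIndependent.of_comp W.subtype
      exact hli
    have := hu.fintype_card_le_finrank
    simp at this
    omega
  rw [Fintype.not_linearIndependent_iff] at hdep
  obtain ⟨g, hg, i0, hi0⟩ := hdep
  obtain ⟨i, hi, hmax⟩ := (Finset.univ.filter fun i => g i ≠ 0).exists_max_image id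
    ⟨i0, by simp [hi0]⟩
  simp only [Finset.mem_filter, Finset.mem_univ, true_and, id] at hi hmax
  have hq : q = p + 1 + i + (q - (p+1+i)) := by omega
  set r := q - (p + 1 + i) with hr
  have happ : ∑ l : Fin (n+1), g l • v (p + 1 + l + r) = 0 := by
    have := congrArg (fun y => (A ^ r) *ᵥ y) hg
    simp only [Matrix.mulVec_sum, Matrix.mulVec_smul, Matrix.mulVec_zero, ← hv] at this
    exact this
  rw [← Finset.add_sum_erase _ _ (Finset.mem_univ i), ← hq] at happ
  have hrest : ∑ l ∈ Finset.univ.erase i, g l • v (p + 1 + l + r) ∈ W := by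
    refine Submodule.sum_mem _ fun l hl => ?_
    by_cases hgl : g l = 0
    · simp [hgl]
    · refine W.smul_mem _ (hmem _ (by omega) ?_)
      have h1 := hmax l hgl
      have h2 : l ≠ i := Finset.ne_of_mem_erase hl
      have h3 : (l : ℕ) < i := by
        have := lt_of_le_of_ne h1 h2
        exact this
      omega
  have h4 : g i • v q ∈ W := by
    rw [eq_neg_of_add_eq_zero_left happ]
    exact W.neg_mem hrest
  exact (W.smul_mem_iff hi).1 h4

theorem strictMono_add_le {n : ℕ} (c : Fin (n+1) → ℕ) (hc : StrictMono c) (i : Fin (n+1)) :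
    c 0 + i ≤ c i := by
  induction i using Fin.induction with
  | zero => simp
  | succ i ih =>
    have := hc (Fin.castSucc_lt_succ (i := i))
    simp only [Fin.val_castSucc, Fin.val_succ] at *
    omega

theorem strictMono_le_last {n : ℕ} (c : Fin (n+1) → ℕ) (hc : StrictMono c) (i : Fin (n+1)) :
    c i + (n - i) ≤ c (Fin.last n) := by
  induction i using Fin.reverseInduction with
  | last => simp
  | cast i ih =>
    have := hc (Fin.castSucc_lt_succ (i := i))
    simp only [Fin.val_castSucc, Fin.val_succ] at *
    omega

theorem sminor_zero_of_dep {K n : ℕ} (v : ℕ → Fin K → ℝ) (I : Fin n → Fin K) (c : Fin n → ℕ)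
    (h : ¬ LinearIndependent ℝ (fun a => v (c a))) : sminor v I c = 0 := by
  unfold sminor
  apply Matrix.det_eq_zero_of_not_linearIndependent_rows
  intro hli
  apply h
  apply LinearIndependent.of_comp (LinearMap.funLeft ℝ ℝ I)
  exact hli

theorem sminor_nonneg {K k : ℕ} (A : Matrix (Fin K) (Fin K) ℝ) (v : ℕ → Fin K → ℝ)
    (hv : ∀ s r, v (s + r) = (A ^ r) *ᵥ v s)
    (hcons : ∀ j, j ≤ k → ∀ (I : Fin j → Fin K), StrictMono I → ∀ s,
      0 ≤ sminor v I (fun a => s + (a : ℕ))) :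
    ∀ j, j ≤ k → ∀ (c : Fin j → ℕ), StrictMono c → ∀ (I : Fin j → Fin K), StrictMono I →
      0 ≤ sminor v I c := by
  intro j
  induction j with
  | zero => intro _ c _ I _; simp [sminor]
  | succ j ih =>
    intro hj
    rcases j with _ | n
    · intro c hc I hI
      have : c = fun a : Fin _ => c 0 + (a : ℕ) := by
        funext a
        have : a = 0 := Fin.ext (by have := a.isLt; simp only [Fin.val_zero]; omega)
        subst this; simp
      rw [this]
      exact hcons 1 hj I hI _
    have ih' := ih (by omega)
    suffices H : ∀ d, ∀ (c : Fin (n+2) → ℕ), StrictMono c → c (Fin.last (n+1)) - c 0 ≤ d →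
        ∀ (I : Fin (n+2) → Fin K), StrictMono I → 0 ≤ sminor v I c from
      fun c hc => H _ c hc le_rfl
    intro d
    induction d with
    | zero =>
      intro c hc h0
      have := hc (Fin.last_pos (n := n))
      omega
    | succ d ihd =>
      intro c hc hd I hI
      by_cases hgap : c (Fin.last (n+1)) ≤ c 0 + (n + 1)
      · have : c = fun a : Fin _ => c 0 + (a : ℕ) := by
          funext a
          have h1 := strictMono_add_le c hc a
          have h2 := strictMono_le_last c hc a
          omega
        rw [this]
        exact hcons _ hj I hI _
      obtain ⟨p, hp⟩ : ∃ p, p = c 0 := ⟨_, rfl⟩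
      obtain ⟨q, hq⟩ : ∃ q, q = c (Fin.last (n+1)) := ⟨_, rfl⟩
      let T : Fin n → ℕ := fun i => c i.succ.castSucc
      have hT : StrictMono T := fun a b h => hc (by simpa using h)
      have hceq : c = (Fin.cons p (Fin.insertNth (Fin.last n) q T : Fin (n+1) → ℕ) : Fin (n+2) → ℕ) := by
        funext i
        refine Fin.cases ?_ (fun i => ?_) i
        · simp [hp]
        · refine Fin.lastCases ?_ (fun i => ?_) i
          · simp [hq]
          · simp [T]
      rw [← hp, ← hq] at hd hgap
      have hpT : ∀ i, p < T i := fun i => by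
        rw [hp]; exact hc (by rw [Fin.lt_def]; simp)
      have hTq : ∀ i, T i < q := fun i => by
        rw [hq]; exact hc (Fin.castSucc_lt_last _)
      have hs5 : StrictMono (Fin.insertNth (Fin.last n) q T : Fin (n+1) → ℕ) := by
        rw [Fin.strictMono_insertNth_iff]
        refine ⟨hT, fun i _ => hTq i, fun i hi => ?_⟩
        exact absurd hi (not_le.2 (Fin.castSucc_lt_last i))
      have hs3 : StrictMono (Fin.insertNth 0 p T : Fin (n+1) → ℕ) := by
        rw [Fin.strictMono_insertNth_iff]
        refine ⟨hT, fun i hi => ?_, fun i _ => hpT i⟩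
        exact absurd hi (Fin.not_lt_zero _)
      by_cases hx : ∃ x, p < x ∧ x < q ∧ (∀ i, T i ≠ x) ∧ ∃ m : Fin (n+1),
          StrictMono (Fin.insertNth m x T : Fin (n+1) → ℕ) ∧
          LinearIndependent ℝ (fun a => v ((Fin.insertNth m x T : Fin (n+1) → ℕ) a))
      · obtain ⟨x, hpx, hxq, hxT, m, hm, hli⟩ := hx
        have hall : ∀ i, p < (Fin.insertNth m x T : Fin (n+1) → ℕ) i ∧
            (Fin.insertNth m x T : Fin (n+1) → ℕ) i < q := by
          intro i
          refine Fin.succAboveCases m ?_ (fun i => ?_) i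
          · simp [hpx, hxq]
          · simp [hpT, hTq]
        have hs4 : StrictMono (Fin.insertNth (Fin.last (n+1)) q
            (Fin.insertNth m x T : Fin (n+1) → ℕ) : Fin (n+2) → ℕ) := by
          rw [Fin.strictMono_insertNth_iff]
          refine ⟨hm, fun i _ => (hall i).2, fun i hi => ?_⟩
          exact absurd hi (not_le.2 (Fin.castSucc_lt_last i))
        have hs6 : StrictMono (Fin.cons p (Fin.insertNth m x T : Fin (n+1) → ℕ) : Fin (n+2) → ℕ) :=
          Fin.strictMono_cons.2 ⟨fun i => (hall i).1, hm⟩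
        rw [hceq]
        refine fekete_step v T p x q m (ih' _ hm) (ih' _ hs3) (ihd _ hs4 ?_) (ih' _ hs5)
          (ihd _ hs6 ?_) hli I hI
        · have h0 := (hall 0).1
          have : (Fin.insertNth (Fin.last (n+1)) q
            (Fin.insertNth m x T : Fin (n+1) → ℕ) : Fin (n+2) → ℕ) 0 =
              (Fin.insertNth m x T : Fin (n+1) → ℕ) 0 := by
            rw [Fin.insertNth_last', ← Fin.castSucc_zero, Fin.snoc_castSucc]
          rw [this, Fin.insertNth_apply_same]
          omega
        · have h0 := (hall (Fin.last n)).2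
          rw [← Fin.succ_last, Fin.cons_succ, Fin.cons_zero]
          omega
      · -- degenerate case: the minor vanishes
        refine le_of_eq (Eq.symm ?_)
        apply sminor_zero_of_dep
        intro hcli
        have hTli : LinearIndependent ℝ (fun a => v (T a)) :=
          hcli.comp (fun i : Fin n => i.succ.castSucc) (fun a b h => by simpa using h)
        let W : Submodule ℝ (Fin K → ℝ) := Submodule.span ℝ (Set.range fun a => v (T a))
        have hW : Module.finrank ℝ W ≤ n := by
          have := finrank_range_le_card (R := ℝ) (fun a => v (T a))
          rw [Fintype.card_fin] at this
          exact this
        have hmem : ∀ x, p < x → x < q → v x ∈ W := by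
          intro x hpx hxq
          by_cases hxT : ∀ i, T i ≠ x
          · by_contra hnot
            obtain ⟨m, hm⟩ := exists_insert_pos T hT x hxT
            refine hx ⟨x, hpx, hxq, hxT, m, hm, ?_⟩
            have h1 : LinearIndependent ℝ (Fin.cons (v x) (fun a => v (T a)) : Fin (n+1) → Fin K → ℝ) :=
              linearIndependent_finCons.2 ⟨hTli, hnot⟩
            have h2 : (fun a => v ((Fin.insertNth m x T : Fin (n+1) → ℕ) a)) =
                (Fin.cons (v x) (fun a => v (T a)) : Fin (n+1) → Fin K → ℝ) ∘ m.cycleRange := by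
              rw [Fin.cons_comp_cycleRange, Fin.eq_insertNth_iff]
              refine ⟨by simp, ?_⟩
              funext i; simp [Fin.removeNth]
            rw [h2]
            exact h1.comp _ (Equiv.injective _)
          · push Not at hxT
            obtain ⟨i, rfl⟩ := hxT
            exact Submodule.subset_span ⟨i, rfl⟩
        have hvq := krylov_mem A v hv W hW p q (by omega) hmem
        have hsn : LinearIndependent ℝ (fun a : Fin (n+1) => v (c a.succ)) :=
          hcli.comp (fun i : Fin (n+1) => i.succ) (Fin.succ_injective _)
        have hsn2 : (fun a : Fin (n+1) => v (c a.succ)) =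
            (Fin.snoc (fun a => v (T a)) (v q) : Fin (n+1) → Fin K → ℝ) := by
          funext i
          refine Fin.lastCases ?_ (fun i => ?_) i
          · simp [hq]
          · simp [T]
        rw [hsn2, linearIndependent_finSnoc] at hsn
        exact hsn.2 hvq

theorem compound_to_minor {n m : ℕ} (X : Matrix (Fin n) (Fin m) ℝ) (r : ℕ)
    (h : ∀ I J, 0 ≤ compound X r I J) (f : Fin r → Fin n) (g : Fin r → Fin m)
    (hf : StrictMono f) (hg : StrictMono g) : 0 ≤ (X.submatrix f g).det := by
  have hcf : (Finset.univ.image f).card = r := by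
    rw [Finset.card_image_of_injective _ hf.injective]; simp
  have hcg : (Finset.univ.image g).card = r := by
    rw [Finset.card_image_of_injective _ hg.injective]; simp
  have := h ⟨_, hcf⟩ ⟨_, hcg⟩
  unfold compound at this
  rw [← Finset.orderEmbOfFin_unique hcf (fun x => Finset.mem_image_of_mem f (Finset.mem_univ x)) hf,
    ← Finset.orderEmbOfFin_unique hcg (fun x => Finset.mem_image_of_mem g (Finset.mem_univ x)) hg]
    at this
  exact this

theorem pow_minor_nonneg {K r : ℕ} (A : Matrix (Fin K) (Fin K) ℝ)
    (h : ∀ f g : Fin r → Fin K, StrictMono f → StrictMono g → 0 ≤ (A.submatrix f g).det) (s : ℕ) :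
    ∀ f g : Fin r → Fin K, StrictMono f → StrictMono g → 0 ≤ ((A ^ s).submatrix f g).det := by
  induction s with
  | zero =>
    intro f g hf hg
    -- minors of the identity
    rw [pow_zero]
    by_cases hfg : f = g
    · subst hfg
      rw [Matrix.submatrix_one _ hf.injective, Matrix.det_one]; exact zero_le_one
    · -- some value of `f` is not a value of `g`
      have : ∃ i, ∀ j, f i ≠ g j := by
        by_contra! hcon
        apply hfg
        have hsub : Set.range f ⊆ Set.range g := by
          rintro _ ⟨i, rfl⟩
          obtain ⟨j, hj⟩ := hcon i
          exact ⟨j, hj.symm⟩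
        have hr : Finset.univ.image f = Finset.univ.image g := by
          apply Finset.eq_of_subset_of_card_le
          · intro x hx
            obtain ⟨i, _, rfl⟩ := Finset.mem_image.1 hx
            obtain ⟨j, hj⟩ := hcon i
            exact Finset.mem_image.2 ⟨j, Finset.mem_univ _, hj.symm⟩
          · rw [Finset.card_image_of_injective _ hf.injective,
              Finset.card_image_of_injective _ hg.injective]
        refine (StrictMono.range_inj hf hg).1 ?_
        have := congrArg (fun s : Finset (Fin K) => (s : Set (Fin K))) hr
        simpa using this
      obtain ⟨i, hi⟩ := this
      rw [Matrix.det_eq_zero_of_row_eq_zero i]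
      intro j
      simp [Matrix.one_apply_ne (hi j)]
  | succ s ih =>
    intro f g hf hg
    have : (A ^ (s+1)).submatrix f g = (A ^ s).submatrix f id * A.submatrix id g := by
      rw [pow_succ]; rfl
    rw [this]
    exact cb_nonneg _ _ (fun l hl => ih f l hf hl) (fun l hl => h l g hl hg)

/-- Main theorem (controllability part): if `A ∈ ℝ^{K×K}` is `k`-positive,
`(C_j(A,b))_[j] ≥ 0` for `1 ≤ j ≤ k` and `rank (A^{K−j} C_j(A,b)) = j` for
`1 ≤ j ≤ k−1`, then the truncated controllability matrix `C_t(A,b)` is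
`k`-positive for every `t ≥ k`. -/
theorem ctrb_kPositive {K : ℕ} (k : ℕ) (A : Matrix (Fin K) (Fin K) ℝ) (b : Fin K → ℝ)
    (hA : ∀ j, 1 ≤ j → j ≤ k → ∀ I J, 0 ≤ compound A j I J)
    (hC : ∀ j, 1 ≤ j → j ≤ k → ∀ I J, 0 ≤ compound (ctrb A b j) j I J)
    (hrank : ∀ j, 1 ≤ j → j ≤ k - 1 → (A ^ (K - j) * ctrb A b j).rank = j) :
    ∀ t, k ≤ t → ∀ j, 1 ≤ j → j ≤ k → ∀ I J, 0 ≤ compound (ctrb A b t) j I J := by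
  intro t _ j _ hjk I J
  have hv : ∀ s r, (A ^ (s + r)) *ᵥ b = (A ^ r) *ᵥ ((A ^ s) *ᵥ b) := by
    intro s r
    rw [Matrix.mulVec_mulVec, ← pow_add, add_comm]
  have main := sminor_nonneg (k := k) A (fun s => (A ^ s) *ᵥ b) hv ?_ j hjk
    (fun a => ((J.1.orderEmbOfFin J.2 a : Fin t) : ℕ))
    (fun a b h => (J.1.orderEmbOfFin J.2).strictMono h) (I.1.orderEmbOfFin I.2)
    (I.1.orderEmbOfFin I.2).strictMono
  · rw [sminor, ← Matrix.det_transpose] at main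
    exact main
  · intro r hr I hI s
    rcases Nat.eq_zero_or_pos r with rfl | hr0
    · simp [sminor]
    have e : sminor (fun s => (A ^ s) *ᵥ b) I (fun a => s + (a : ℕ)) =
        ((A ^ s).submatrix I id * ctrb A b r).det := by
      rw [sminor, ← Matrix.det_transpose]
      congr 1
      ext x y
      simp only [Matrix.transpose_apply, Matrix.of_apply]
      rw [add_comm, hv]
      rfl
    rw [e]
    refine cb_nonneg _ _ (fun g hg => ?_) (fun g hg => ?_)
    · exact pow_minor_nonneg A (fun f g hf hg => compound_to_minor A r (hA r hr0 hr) f g hf hg)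
        s I g hI hg
    · exact compound_to_minor _ r (hC r hr0 hr) g id hg strictMono_id
end
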